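/- arXiv:2212.01022 — 3 statements merged into one kernel-verified Lean document; each statement's English description precedes it below -/
import Mathlib

section
/- For every n ≥ 1, every smoothness parameter μ > 0, and every vector ρ : Fin n → ℝ, the SSS conjunction operator is min-max bounded: min_i ρ_i ≤ A(ρ_1, …, ρ_n) ≤ max_i ρ_i. -/
/-- The Gaussian error function `erf x = (2/√π) · ∫₀ˣ exp(−t²) dt`. -/
noncomputable def erf (x : ℝ) : ℝ :=
  (2 / Real.sqrt Real.pi) * ∫ t in (0:ℝ)..x, Real.exp (-t ^ 2)

/-- `δmax(ρ) = max_i ρ_i − min_i ρ_i`. -/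
noncomputable def deltaMax {n : ℕ} (hn : 0 < n) (ρ : Fin n → ℝ) : ℝ :=
  Finset.univ.sup' ⟨⟨0, hn⟩, Finset.mem_univ _⟩ ρ -
    Finset.univ.inf' ⟨⟨0, hn⟩, Finset.mem_univ _⟩ ρ

/-- The SSS conjunction operator
`A(ρ) = (Σ_i ρ_i − δmax(ρ)·erf(μ·δmax(ρ)))/n`. -/
noncomputable def SSSand {n : ℕ} (hn : 0 < n) (μ : ℝ) (ρ : Fin n → ℝ) : ℝ :=
  ((∑ i, ρ i) - deltaMax hn ρ * erf (μ * deltaMax hn ρ)) / n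

theorem erf_nonneg {x : ℝ} (hx : 0 ≤ x) : 0 ≤ erf x :=
  mul_nonneg (by positivity)
    (intervalIntegral.integral_nonneg hx fun _ _ => (Real.exp_pos _).le)

theorem erf_le_one {x : ℝ} (hx : 0 ≤ x) : erf x ≤ 1 := by
  have hint : MeasureTheory.Integrable fun t : ℝ => Real.exp (-t ^ 2) := by
    simpa using integrable_exp_neg_mul_sq (b := 1) one_pos
  have hIoi : ∫ t in Set.Ioi (0 : ℝ), Real.exp (-t ^ 2) = √Real.pi / 2 := by
    simpa using integral_gaussian_Ioi 1
  have hle : ∫ t in (0 : ℝ)..x, Real.exp (-t ^ 2) ≤ √Real.pi / 2 := by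
    rw [intervalIntegral.integral_of_le hx, ← hIoi]
    exact MeasureTheory.setIntegral_mono_set hint.integrableOn
      (Filter.Eventually.of_forall fun _ => (Real.exp_pos _).le)
      Set.Ioc_subset_Ioi_self.eventuallyLE
  have hpi : 0 < √Real.pi := Real.sqrt_pos.2 Real.pi_pos
  calc erf x ≤ 2 / √Real.pi * (√Real.pi / 2) :=
        mul_le_mul_of_nonneg_left hle (by positivity)
    _ = 1 := by field_simp

theorem deltaMax_nonneg {n : ℕ} (hn : 0 < n) (ρ : Fin n → ℝ) : 0 ≤ deltaMax hn ρ :=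
  sub_nonneg.2 <| (Finset.inf'_le ρ (Finset.mem_univ ⟨0, hn⟩)).trans
    (Finset.le_sup' ρ (Finset.mem_univ ⟨0, hn⟩))

/-- Since the maximum is attained, the sum exceeds `n` times the minimum by at least `δmax`. -/
theorem card_mul_inf'_add_deltaMax_le_sum {n : ℕ} (hn : 0 < n) (ρ : Fin n → ℝ) :
    n * Finset.univ.inf' ⟨⟨0, hn⟩, Finset.mem_univ _⟩ ρ + deltaMax hn ρ ≤ ∑ i, ρ i := by
  obtain ⟨j, -, hj⟩ := Finset.exists_mem_eq_sup' ⟨⟨0, hn⟩, Finset.mem_univ _⟩ ρ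
  unfold deltaMax
  rw [hj]
  set m := Finset.univ.inf' ⟨⟨0, hn⟩, Finset.mem_univ _⟩ ρ
  have hsingle : ρ j - m ≤ ∑ i, (ρ i - m) :=
    Finset.single_le_sum (f := fun i => ρ i - m)
      (fun i hi => sub_nonneg.2 (Finset.inf'_le ρ hi)) (Finset.mem_univ j)
  simp only [Finset.sum_sub_distrib, Finset.sum_const, Finset.card_univ, Fintype.card_fin,
    nsmul_eq_mul] at hsingle
  linarith

theorem sss_minmax_bounded (n : ℕ) (hn : 1 ≤ n) (μ : ℝ) (hμ : 0 < μ)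
    (ρ : Fin n → ℝ) :
    Finset.univ.inf' ⟨⟨0, hn⟩, Finset.mem_univ _⟩ ρ ≤ SSSand hn μ ρ ∧
      SSSand hn μ ρ ≤ Finset.univ.sup' ⟨⟨0, hn⟩, Finset.mem_univ _⟩ ρ := by
  have hn' : (0 : ℝ) < n := by exact_mod_cast hn
  have hδ := deltaMax_nonneg hn ρ
  have harg : 0 ≤ μ * deltaMax hn ρ := mul_nonneg hμ.le hδ
  unfold SSSand
  rw [le_div_iff₀ hn', div_le_iff₀ hn']
  constructor
  · have hsum := card_mul_inf'_add_deltaMax_le_sum hn ρ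
    have herf := mul_le_of_le_one_right hδ (erf_le_one harg)
    linarith
  · have hsum := Finset.sum_le_card_nsmul Finset.univ ρ
      (Finset.univ.sup' ⟨⟨0, hn⟩, Finset.mem_univ _⟩ ρ) fun i hi => Finset.le_sup' ρ hi
    rw [Finset.card_univ, Fintype.card_fin, nsmul_eq_mul] at hsum
    have herf := mul_nonneg hδ (erf_nonneg harg)
    linarith
end

section
/- The SSS conjunction operator satisfies the shadow-lifting property: for every n ≥ 1, every smoothness parameter μ > 0, every index i, and every ρ ≠ 0, the function ε ↦ A(ρ, …, ρ+ε, …, ρ) (the vector with value ρ at every coordinate except value ρ+ε at coordinate i) has derivative 1/n at ε = 0; in particular this partial derivative is strictly positive. -/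
theorem abs_erf_le (x : ℝ) : |erf x| ≤ 2 / Real.sqrt Real.pi * |x| := by
  have h : ‖∫ t in (0:ℝ)..x, Real.exp (-t ^ 2)‖ ≤ 1 * |x - 0| :=
    intervalIntegral.norm_integral_le_of_norm_le_const fun t _ => by
      rw [Real.norm_eq_abs, Real.abs_exp, Real.exp_le_one_iff]
      nlinarith [sq_nonneg t]
  rw [one_mul, sub_zero, Real.norm_eq_abs] at h
  rw [erf, abs_mul, abs_of_nonneg (by positivity : 0 ≤ 2 / Real.sqrt Real.pi)]
  gcongr

theorem abs_deltaMax_update_const_le {n : ℕ} (hn : 0 < n) (i : Fin n) (r ε : ℝ) :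
    |deltaMax hn (Function.update (fun _ : Fin n => r) i (r + ε))| ≤ |ε| := by
  set v := Function.update (fun _ : Fin n => r) i (r + ε) with hv
  have key : ∀ j k, v j - v k ≤ |ε| := by
    intro j k
    have h₁ := le_abs_self ε
    have h₂ := neg_abs_le ε
    have h₃ := abs_nonneg ε
    simp only [hv, Function.update_apply]
    split_ifs <;> linarith
  have hne : (Finset.univ : Finset (Fin n)).Nonempty := ⟨⟨0, hn⟩, Finset.mem_univ _⟩
  obtain ⟨j, -, hj⟩ := Finset.exists_mem_eq_sup' hne v
  obtain ⟨k, -, hk⟩ := Finset.exists_mem_eq_inf' hne v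
  rw [deltaMax, hj, hk, abs_le]
  exact ⟨by linarith [key k j], key j k⟩

/-- Near a constant vector the penalty term of `SSSand` is quadratically small. -/
theorem hasDerivAt_deltaMax_mul_erf_update_const {n : ℕ} (hn : 0 < n) (μ : ℝ) (i : Fin n)
    (r : ℝ) :
    HasDerivAt (fun ε : ℝ =>
      deltaMax hn (Function.update (fun _ : Fin n => r) i (r + ε)) *
        erf (μ * deltaMax hn (Function.update (fun _ : Fin n => r) i (r + ε)))) 0 0 := by
  rw [hasDerivAt_iff_hasFDerivAt, ContinuousLinearMap.toSpanSingleton_zero]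
  refine Asymptotics.IsBigO.hasFDerivAt (n := 2) ?_ one_lt_two
  refine Asymptotics.IsBigO.of_bound (2 / Real.sqrt Real.pi * |μ|)
    (Filter.Eventually.of_forall fun ε => ?_)
  have hδ := abs_deltaMax_update_const_le hn i r ε
  set δ := deltaMax hn (Function.update (fun _ : Fin n => r) i (r + ε))
  calc ‖δ * erf (μ * δ)‖ = |δ| * |erf (μ * δ)| := by rw [Real.norm_eq_abs, abs_mul]
    _ ≤ |δ| * (2 / Real.sqrt Real.pi * |μ * δ|) := by gcongr; exact abs_erf_le _
    _ = 2 / Real.sqrt Real.pi * |μ| * |δ| ^ 2 := by rw [abs_mul]; ring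
    _ ≤ 2 / Real.sqrt Real.pi * |μ| * |ε| ^ 2 := by gcongr
    _ = _ := by simp

theorem sum_update_const {n : ℕ} (i : Fin n) (r ε : ℝ) :
    ∑ j, Function.update (fun _ : Fin n => r) i (r + ε) j = n * r + ε := by
  rw [Finset.sum_update_of_mem (Finset.mem_univ i), add_right_comm, ← Finset.compl_eq_univ_sdiff,
    ← Fintype.sum_eq_add_sum_compl i (fun _ : Fin n => r)]
  simp

theorem sss_shadow_lifting (n : ℕ) (hn : 1 ≤ n) (μ : ℝ) (hμ : 0 < μ)
    (i : Fin n) (r : ℝ) (hr : r ≠ 0) :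
    HasDerivAt (fun ε : ℝ => SSSand hn μ (Function.update (fun _ : Fin n => r) i (r + ε)))
      (1 / (n : ℝ)) 0 ∧ 0 < (1 : ℝ) / (n : ℝ) := by
  have hn' : (0 : ℝ) < n := by exact_mod_cast hn
  refine ⟨?_, by positivity⟩
  simp only [SSSand, sum_update_const]
  simpa using (((hasDerivAt_id (0 : ℝ)).const_add (n * r)).sub
    (hasDerivAt_deltaMax_mul_erf_update_const hn μ i r)).div_const (n : ℝ)
end

section
/- Aggregate soundness, part 1: for every n ≥ 1, every smoothness parameter μ > 0, and every vector ρ : Fin n → ℝ, if ρ_i > 0 for all i, then A(ρ_1, …, ρ_n) > 0. -/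
theorem deltaMax_lt_sum {n : ℕ} (hn : 0 < n) {ρ : Fin n → ℝ} (hρ : ∀ i, 0 < ρ i) :
    deltaMax hn ρ < ∑ i, ρ i := by
  have hinf : 0 < Finset.univ.inf' ⟨⟨0, hn⟩, Finset.mem_univ _⟩ ρ :=
    (Finset.lt_inf'_iff _).2 fun i _ => hρ i
  have hsup : Finset.univ.sup' ⟨⟨0, hn⟩, Finset.mem_univ _⟩ ρ ≤ ∑ i, ρ i :=
    Finset.sup'_le _ _ fun i hi =>
      Finset.single_le_sum (fun j _ => (hρ j).le) hi
  unfold deltaMax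
  linarith

theorem sss_aggregate_soundness_pos (n : ℕ) (hn : 1 ≤ n) (μ : ℝ) (hμ : 0 < μ)
    (ρ : Fin n → ℝ) (hρ : ∀ i, 0 < ρ i) :
    0 < SSSand hn μ ρ := by
  have hδ := deltaMax_nonneg hn ρ
  have hmul : deltaMax hn ρ * erf (μ * deltaMax hn ρ) ≤ deltaMax hn ρ :=
    mul_le_of_le_one_right hδ (erf_le_one (mul_nonneg hμ.le hδ))
  exact div_pos (sub_pos.2 (hmul.trans_lt (deltaMax_lt_sum hn hρ))) (Nat.cast_pos.2 hn)
end
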